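/- arXiv:2605.11833 — 2 statements merged into one kernel-verified Lean document; each statement's English description precedes it below -/
import Mathlib

section
/- Theorem 5.6(3) (two cycles through a common boundary point give uncountably many addresses): Let K be the attractor of a system of injective contractions S_i (i ∈ I) on a complete metric space. Suppose p ∈ K satisfies S_u(p) = p and S_v(p) = p for two nonempty finite words u, v over I with uv ≠ vu (as words). Then for every finite word w over I (including the empty word) the set of addresses of the point S_w(p) is uncountable. -/
/-- `SWord S w` is the composition `S_{i₁} ∘ ⋯ ∘ S_{iₙ}` for the word `w = i₁…iₙ`
(the identity for the empty word). -/
def SWord {X : Type*} {m : ℕ} (S : Fin m → X → X) : List (Fin m) → X → X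
  | [] => id
  | i :: w => S i ∘ SWord S w

/-- `α : ℕ → Fin m` is an address of `x` if `x ∈ K_{α|n} = S_{α(0)…α(n-1)}(K)`
for every `n ≥ 1`. -/
def IsAddress {X : Type*} {m : ℕ} (S : Fin m → X → X) (K : Set X) (x : X)
    (α : ℕ → Fin m) : Prop :=
  ∀ n : ℕ, 1 ≤ n → x ∈ SWord S (List.ofFn fun k : Fin n => α k.val) '' K

/-- The critical set `C = ⋃_{i ≠ j} (K_i ∩ K_j)`. -/
def CriticalSet {X : Type*} {m : ℕ} (S : Fin m → X → X) (K : Set X) : Set X :=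
  ⋃ (i : Fin m) (j : Fin m) (_ : i ≠ j), (S i '' K) ∩ (S j '' K)

/-- The self-similar boundary
`∂K = {x ∈ K : S_w(x) ∈ C for some nonempty word w}`. -/
def SSBoundary {X : Type*} {m : ℕ} (S : Fin m → X → X) (K : Set X) : Set X :=
  {x | x ∈ K ∧ ∃ w : List (Fin m), w ≠ [] ∧ SWord S w x ∈ CriticalSet S K}

/-- `K` is a dendrite: compact, connected, locally connected (as a subspace), and
admitting no continuous injection of the unit circle. -/
def IsDendrite {X : Type*} [TopologicalSpace X] (K : Set X) : Prop :=
  IsCompact K ∧ IsConnected K ∧ LocallyConnectedSpace K ∧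
    ∀ f : (Metric.sphere (0 : ℂ) 1) → K, Continuous f → ¬ Function.Injective f

/-- The set of connected components of the set `A`. -/
def ComponentsIn {X : Type*} [TopologicalSpace X] (A : Set X) : Set (Set X) :=
  {C | ∃ y ∈ A, C = connectedComponentIn A y}

/-- The main tree of `K`: the intersection of all closed connected sets `A` with
`∂K ⊆ A ⊆ K`. -/
def MainTree {X : Type*} [TopologicalSpace X] {m : ℕ} (S : Fin m → X → X)
    (K : Set X) : Set X :=
  ⋂₀ {A : Set X | IsClosed A ∧ IsConnected A ∧ SSBoundary S K ⊆ A ∧ A ⊆ K}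

theorem SWord_append {X : Type*} {m : ℕ} (S : Fin m → X → X) (a b : List (Fin m)) (x : X) :
    SWord S (a ++ b) x = SWord S a (SWord S b x) := by
  induction a with
  | nil => rfl
  | cons i a ih => simp [SWord, ih]

theorem SWord_mem {X : Type*} {m : ℕ} (S : Fin m → X → X) (K : Set X)
    (hK : ∀ i, Set.MapsTo (S i) K K) (a : List (Fin m)) {x : X} (hx : x ∈ K) :
    SWord S a x ∈ K := by
  induction a with
  | nil => exact hx
  | cons i a ih => exact hK i ih

/-- `α` is an address of `x` if arbitrarily long prefixes of `α` map some point of `K` to `x`. -/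
theorem isAddress_of_frequently {X : Type*} {m : ℕ} (S : Fin m → X → X) (K : Set X)
    (hK : ∀ i, Set.MapsTo (S i) K K) (α : ℕ → Fin m) {x : X}
    (h : ∀ n, ∃ N ≥ n, ∃ p ∈ K, SWord S ((List.range N).map α) p = x) :
    IsAddress S K x α := by
  intro n _
  obtain ⟨N, hN, p, hp, hx⟩ := h n
  obtain ⟨d, rfl⟩ := Nat.exists_eq_add_of_le hN
  rw [List.range_add, List.map_append, SWord_append] at hx
  have e : (List.ofFn fun k : Fin n => α k) = (List.range n).map α := by
    apply List.ext_getElem <;> simp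
  rw [e]
  exact ⟨_, SWord_mem S K hK _ hp, hx⟩

/-- The infinite word `w c(f 0) c(f 1) c(f 2) …` where all the words `c b` have length `L`;
`d` is a default letter. -/
def blockSeq {A B : Type*} (d : A) (w : List A) (L : ℕ) (c : B → List A) (f : ℕ → B)
    (n : ℕ) : A :=
  if n < w.length then w.getD n d
  else (c (f ((n - w.length) / L))).getD ((n - w.length) % L) d

theorem map_range_blockSeq {A B : Type*} (d : A) (w : List A) (L : ℕ) (c : B → List A)
    (f : ℕ → B) : (List.range w.length).map (blockSeq d w L c f) = w := by
  apply List.ext_getElem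
  · simp
  · intro i h₁ h₂
    simp [blockSeq, h₂]

theorem map_block_blockSeq {A B : Type*} (d : A) (w : List A) (L : ℕ) (c : B → List A)
    (hc : ∀ b, (c b).length = L) (f : ℕ → B) (k : ℕ) :
    (List.range L).map (fun j => blockSeq d w L c f (w.length + k * L + j)) = c (f k) := by
  apply List.ext_getElem
  · simp [hc]
  · intro i h₁ h₂
    have hi : i < L := hc (f k) ▸ h₂
    have e : w.length + k * L + i - w.length = i + L * k := by
      rw [Nat.mul_comm L k]; omega
    have e' : ¬ w.length + k * L + i < w.length := by omega
    simp only [List.getElem_map, List.getElem_range, blockSeq, if_neg e', e]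
    rw [Nat.add_mul_div_left _ _ (by omega), Nat.add_mul_mod_self_left, Nat.div_eq_of_lt hi,
      Nat.mod_eq_of_lt hi, Nat.zero_add]
    exact List.getD_eq_getElem _ _ h₂

theorem blockSeq_injective {A B : Type*} (d : A) (w : List A) (L : ℕ) (c : B → List A)
    (hc : ∀ b, (c b).length = L) (hinj : Function.Injective c) :
    Function.Injective (blockSeq d w L c) := by
  intro f g hfg
  funext k
  apply hinj
  rw [← map_block_blockSeq d w L c hc f k, ← map_block_blockSeq d w L c hc g k, hfg]

theorem SWord_blockSeq {X B : Type*} {m : ℕ} (S : Fin m → X → X) (d : Fin m)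
    (w : List (Fin m)) (L : ℕ) (c : B → List (Fin m)) (hc : ∀ b, (c b).length = L) {p : X}
    (hp : ∀ b, SWord S (c b) p = p) (f : ℕ → B) (k : ℕ) :
    SWord S ((List.range (w.length + k * L)).map (blockSeq d w L c f)) p = SWord S w p := by
  induction k with
  | zero => rw [Nat.zero_mul, Nat.add_zero, map_range_blockSeq]
  | succ k ih =>
    rw [Nat.succ_mul, ← Nat.add_assoc, List.range_add, List.map_append, List.map_map,
      SWord_append]
    have h := map_block_blockSeq d w L c hc f k
    rw [show (List.range L).map (blockSeq d w L c f ∘ fun x => w.length + k * L + x) =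
      c (f k) from h, hp, ih]

/-- **Theorem 5.6(3)**: two cycles through a common boundary point give uncountably
many addresses for every image of that point. -/
theorem uncountably_many_addresses_of_two_cycles
    {X : Type*} [MetricSpace X] [CompleteSpace X] {m : ℕ}
    (S : Fin m → X → X) (r : Fin m → NNReal) (hr : ∀ i, r i < 1)
    (hlip : ∀ i, LipschitzWith (r i) (S i)) (hinj : ∀ i, Function.Injective (S i))
    (K : Set X) (hKne : K.Nonempty) (hKcp : IsCompact K) (hKeq : K = ⋃ i, S i '' K)
    (p : X) (hp : p ∈ K) (u v : List (Fin m)) (hu : u ≠ []) (hv : v ≠ [])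
    (hSu : SWord S u p = p) (hSv : SWord S v p = p) (huv : u ++ v ≠ v ++ u) :
    ∀ w : List (Fin m), ¬ {α : ℕ → Fin m | IsAddress S K (SWord S w p) α}.Countable := by
  intro w hcount
  have hK : ∀ i, Set.MapsTo (S i) K K := fun i x hx => by
    rw [hKeq]
    exact Set.mem_iUnion_of_mem i (Set.mem_image_of_mem _ hx)
  have hupos : 0 < u.length := List.length_pos_iff.mpr hu
  set c : Bool → List (Fin m) := fun b => if b then u ++ v else v ++ u with hcdef
  have hc : ∀ b, (c b).length = u.length + v.length := by
    intro b
    cases b <;> simp [hcdef, Nat.add_comm]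
  have hcp : ∀ b, SWord S (c b) p = p := by
    intro b
    cases b <;> simp [hcdef, SWord_append, hSu, hSv]
  have hcinj : Function.Injective c := by
    intro a b h
    cases a <;> cases b
    · rfl
    · exact absurd h.symm huv
    · exact absurd h huv
    · rfl
  have hrange : Set.range (blockSeq (u.head hu) w (u.length + v.length) c) ⊆
      {α : ℕ → Fin m | IsAddress S K (SWord S w p) α} := by
    rintro _ ⟨f, rfl⟩
    refine isAddress_of_frequently S K hK _ fun n =>
      ⟨w.length + n * (u.length + v.length), ?_, p, hp, SWord_blockSeq S _ w _ c hc hcp f n⟩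
    nlinarith
  have hcountable := (hcount.mono hrange).preimage_of_injOn
    (blockSeq_injective (u.head hu) w _ c hc hcinj).injOn
  rw [Set.preimage_range] at hcountable
  have : Countable (ℕ → Bool) := Set.countable_univ_iff.mp hcountable
  obtain ⟨g, hg⟩ := exists_surjective_nat (ℕ → Bool)
  obtain ⟨n, hn⟩ := hg fun k => !g k k
  simpa using congrFun hn n
end

section
/- Proposition 5.2(4): Let K be the attractor of a system of injective contractions S_i (i ∈ I) on a complete metric space, suppose K is a dendrite and the self-similar boundary ∂K is finite. If x ∈ K has exactly one address α and x is a ramification point (K \ {x} has at least three connected components), then α is preperiodic: there exist N ≥ 0 and T ≥ 1 such that α(n+T) = α(n) for all n ≥ N. -/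
section Separation

/-- In a connected, locally connected space every component of the complement of a point
accumulates at that point. -/
theorem mem_closure_connectedComponentIn_compl_singleton {Y : Type*} [TopologicalSpace Y]
    [T1Space Y] [ConnectedSpace Y] [LocallyConnectedSpace Y] {x y : Y} (hxy : y ≠ x) :
    x ∈ closure (connectedComponentIn {x}ᶜ y) := by
  by_contra hx
  have hy : y ∈ ({x}ᶜ : Set Y) := hxy
  have hmem := mem_connectedComponentIn hy
  have hclosure : closure (connectedComponentIn {x}ᶜ y) ⊆ connectedComponentIn {x}ᶜ y := by
    refine isPreconnected_connectedComponentIn.closure.subset_connectedComponentIn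
      (subset_closure hmem) ?_
    rintro z hz rfl
    exact hx hz
  have hclopen : IsClopen (connectedComponentIn {x}ᶜ y) :=
    ⟨isClosed_of_closure_subset hclosure, isOpen_compl_singleton.connectedComponentIn⟩
  have huniv := hclopen.eq_univ ⟨y, hmem⟩
  exact hx (by simp [huniv])

theorem mem_closure_connectedComponentIn_diff_singleton {X : Type*} [TopologicalSpace X]
    [T1Space X] {K : Set X} (hK : IsConnected K) [LocallyConnectedSpace K] {x y : X}
    (hx : x ∈ K) (hy : y ∈ K \ {x}) : x ∈ closure (connectedComponentIn (K \ {x}) y) := by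
  have := isConnected_iff_connectedSpace.1 hK
  have hne : (⟨y, hy.1⟩ : K) ≠ ⟨x, hx⟩ := fun h => hy.2 (congrArg Subtype.val h)
  have hcl := mem_closure_connectedComponentIn_compl_singleton hne
  have himage : Subtype.val '' connectedComponentIn {(⟨x, hx⟩ : K)}ᶜ ⟨y, hy.1⟩ ⊆
      connectedComponentIn (K \ {x}) y := by
    refine (isPreconnected_connectedComponentIn.image _
      continuous_subtype_val.continuousOn).subset_connectedComponentIn
      ⟨⟨y, hy.1⟩, mem_connectedComponentIn hne, rfl⟩ ?_
    rintro _ ⟨z, hz, rfl⟩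
    exact ⟨z.2, fun h => connectedComponentIn_subset _ _ hz (Subtype.ext h)⟩
  exact closure_mono himage
    (image_closure_subset_closure_image continuous_subtype_val ⟨_, hcl, rfl⟩)

/-- `SeparatesAll K x a`: the points `a i` lie in pairwise distinct components of `K \ {x}`. -/
def SeparatesAll {X ι : Type*} [TopologicalSpace X] (K : Set X) (x : X) (a : ι → X) : Prop :=
  (∀ i, a i ∈ K \ {x}) ∧ Function.Injective fun i => connectedComponentIn (K \ {x}) (a i)

/-- At most one point of a locally connected, connected set separates three given points. -/
theorem SeparatesAll.unique {X : Type*} [TopologicalSpace X] [T1Space X] {K : Set X}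
    (hK : IsConnected K) [LocallyConnectedSpace K] {x y : X} (hx : x ∈ K)
    {a : Fin 3 → X} (hxa : SeparatesAll K x a) (hya : SeparatesAll K y a) : x = y := by
  by_contra hxy
  have hpair : ∃ i j, i ≠ j ∧ y ∉ connectedComponentIn (K \ {x}) (a i) ∧
      y ∉ connectedComponentIn (K \ {x}) (a j) := by
    have hone : ∀ i j, y ∈ connectedComponentIn (K \ {x}) (a i) →
        y ∈ connectedComponentIn (K \ {x}) (a j) → i = j := fun i j hi hj =>
      hxa.2 ((connectedComponentIn_eq hi).trans (connectedComponentIn_eq hj).symm)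
    by_cases h0 : y ∈ connectedComponentIn (K \ {x}) (a 0)
    · exact ⟨1, 2, by decide, fun h => absurd (hone _ _ h0 h) (by decide),
        fun h => absurd (hone _ _ h0 h) (by decide)⟩
    · by_cases h1 : y ∈ connectedComponentIn (K \ {x}) (a 1)
      · exact ⟨0, 2, by decide, h0, fun h => absurd (hone _ _ h1 h) (by decide)⟩
      · exact ⟨0, 1, by decide, h0, h1⟩
  obtain ⟨i, j, hij, hi, hj⟩ := hpair
  have hpre : ∀ k, IsPreconnected (insert x (connectedComponentIn (K \ {x}) (a k))) := fun k =>
    isPreconnected_connectedComponentIn.subset_closure (Set.subset_insert _ _)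
      (Set.insert_subset (mem_closure_connectedComponentIn_diff_singleton hK hx (hxa.1 k))
        subset_closure)
  have hsub : ∀ k, y ∉ connectedComponentIn (K \ {x}) (a k) →
      insert x (connectedComponentIn (K \ {x}) (a k)) ⊆ K \ {y} := by
    rintro k hk z (rfl | hz)
    · exact ⟨hx, hxy⟩
    · exact ⟨(connectedComponentIn_subset _ _ hz).1, fun h => hk (h ▸ hz)⟩
  have hunion := (hpre i).union x (Set.mem_insert _ _) (Set.mem_insert _ _) (hpre j)
  have hmem := hunion.subset_connectedComponentIn
    (Or.inl (Set.mem_insert_of_mem _ (mem_connectedComponentIn (hxa.1 i))))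
    (Set.union_subset (hsub i hi) (hsub j hj))
    (Or.inr (Set.mem_insert_of_mem _ (mem_connectedComponentIn (hxa.1 j))))
  exact hij (hya.2 (connectedComponentIn_eq hmem))

/-- Separation is reflected by continuous injections of `K` into itself. -/
theorem SeparatesAll.of_map {X ι : Type*} [TopologicalSpace X] {K : Set X} {f : X → X}
    (hf : Continuous f) (hinj : Function.Injective f) (hfK : Set.MapsTo f K K) {x : X}
    {a : ι → X} (ha : ∀ i, a i ∈ K) (h : SeparatesAll K (f x) (f ∘ a)) :
    SeparatesAll K x a := by
  have hax : ∀ i, a i ∈ K \ {x} := fun i => ⟨ha i, fun hi => (h.1 i).2 (congrArg f hi)⟩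
  refine ⟨hax, fun i j hij => h.2 ?_⟩
  have hmem : f (a j) ∈ f '' connectedComponentIn (K \ {x}) (a i) :=
    ⟨a j, (show connectedComponentIn _ (a i) = _ from hij) ▸
      mem_connectedComponentIn (hax j), rfl⟩
  refine connectedComponentIn_eq
    ((isPreconnected_connectedComponentIn.image f hf.continuousOn).subset_connectedComponentIn
      ⟨a i, mem_connectedComponentIn (hax i), rfl⟩ ?_ hmem)
  rintro _ ⟨z, hz, rfl⟩
  have hz' := connectedComponentIn_subset _ _ hz
  exact ⟨hfK hz'.1, fun h => hz'.2 (hinj h)⟩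

end Separation

section Words

/-- `prefixMap S α n = S_{α(0)} ∘ ⋯ ∘ S_{α(n-1)}`. -/
def prefixMap {X : Type*} {m : ℕ} (S : Fin m → X → X) (α : ℕ → Fin m) : ℕ → X → X
  | 0 => id
  | n + 1 => prefixMap S α n ∘ S (α n)

/-- The union of the pieces `S_{α(0)…α(k-1)j}(K)` with `k < n` and `j ≠ α(k)`. -/
def prefixRest {X : Type*} {m : ℕ} (S : Fin m → X → X) (K : Set X) (α : ℕ → Fin m) : ℕ → Set X
  | 0 => ∅
  | n + 1 => prefixRest S K α n ∪ ⋃ j ∈ {j | j ≠ α n}, prefixMap S α n '' (S j '' K)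

/-- `IsItinerary S K α y`: the points `y n ∈ K` satisfy `y n = S_{α(n)} (y (n + 1))`. -/
def IsItinerary {X : Type*} {m : ℕ} (S : Fin m → X → X) (K : Set X) (α : ℕ → Fin m)
    (y : ℕ → X) : Prop :=
  ∀ n, y n ∈ K ∧ S (α n) (y (n + 1)) = y n

variable {X : Type*} {m : ℕ} {S : Fin m → X → X} {K : Set X} {α : ℕ → Fin m}

theorem SWord_append_s15 (v w : List (Fin m)) : SWord S (v ++ w) = SWord S v ∘ SWord S w := by
  induction v with
  | nil => rfl
  | cons i v ih => simp only [List.cons_append, SWord, ih, Function.comp_assoc]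

theorem prefixMap_eq_SWord (n : ℕ) :
    prefixMap S α n = SWord S (List.ofFn fun k : Fin n => α k.val) := by
  induction n with
  | zero => simp [prefixMap, SWord]
  | succ n ih =>
    rw [List.ofFn_succ', List.concat_eq_append, SWord_append_s15, prefixMap, ih]
    simp [SWord]

theorem prefixMap_injective (hinj : ∀ i, Function.Injective (S i)) (n : ℕ) :
    Function.Injective (prefixMap S α n) := by
  induction n with
  | zero => exact Function.injective_id
  | succ n ih => exact ih.comp (hinj _)

theorem prefixMap_mapsTo (hS : ∀ i, Set.MapsTo (S i) K K) (n : ℕ) :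
    Set.MapsTo (prefixMap S α n) K K := by
  induction n with
  | zero => exact Set.mapsTo_id K
  | succ n ih => exact ih.comp (hS _)

theorem prefixMap_continuous [TopologicalSpace X] (hS : ∀ i, Continuous (S i)) (n : ℕ) :
    Continuous (prefixMap S α n) := by
  induction n with
  | zero => exact continuous_id
  | succ n ih => exact ih.comp (hS _)

theorem prefixMap_lipschitzWith [PseudoEMetricSpace X] {ρ : NNReal}
    (hS : ∀ i, LipschitzWith ρ (S i)) (n : ℕ) : LipschitzWith (ρ ^ n) (prefixMap S α n) := by
  induction n with
  | zero => simpa [prefixMap] using LipschitzWith.id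
  | succ n ih => simpa [prefixMap, pow_succ] using ih.comp (hS (α n))

theorem subset_image_prefixMap_union_prefixRest (hK : K ⊆ ⋃ i, S i '' K) (n : ℕ) :
    K ⊆ prefixMap S α n '' K ∪ prefixRest S K α n := by
  induction n with
  | zero => simp [prefixMap]
  | succ n ih =>
    intro z hz
    obtain ⟨u, hu, rfl⟩ | hz := ih hz
    · obtain ⟨j, v, hv, rfl⟩ := Set.mem_iUnion.1 (hK hu)
      by_cases hj : j = α n
      · exact Or.inl ⟨v, hv, by simp [prefixMap, hj]⟩
      · exact Or.inr (Or.inr (Set.mem_biUnion (show j ∈ {j | j ≠ α n} from hj)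
          ⟨_, ⟨v, hv, rfl⟩, rfl⟩))
    · exact Or.inr (Or.inl hz)

theorem isClosed_prefixRest [TopologicalSpace X] [T2Space X] (hK : IsCompact K)
    (hS : ∀ i, Continuous (S i)) (n : ℕ) : IsClosed (prefixRest S K α n) := by
  induction n with
  | zero => exact isClosed_empty
  | succ n ih =>
    exact ih.union (Set.Finite.isClosed_biUnion (Set.toFinite _) fun j _ =>
      ((hK.image (hS j)).image (prefixMap_continuous hS n)).isClosed)

theorem mem_SSBoundary_of_map {i : Fin m} {a : X} (ha : a ∈ K)
    (h : S i a ∈ SSBoundary S K) : a ∈ SSBoundary S K := by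
  obtain ⟨-, w, -, hw⟩ := h
  refine ⟨ha, w ++ [i], by simp, ?_⟩
  rw [SWord_append_s15]
  exact hw

theorem mem_SSBoundary_of_prefixMap_mem_prefixRest (hinj : ∀ i, Function.Injective (S i))
    (hS : ∀ i, Set.MapsTo (S i) K K) (n : ℕ) {a : X} (ha : a ∈ K)
    (h : prefixMap S α n a ∈ prefixRest S K α n) : a ∈ SSBoundary S K := by
  induction n generalizing a with
  | zero => exact h.elim
  | succ n ih =>
    obtain h | h := h
    · exact mem_SSBoundary_of_map ha (ih (hS _ ha) h)
    · obtain ⟨j, hj, u, hu, hua⟩ := Set.mem_iUnion₂.1 h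
      obtain rfl : u = S (α n) a := prefixMap_injective hinj n hua
      exact ⟨ha, [α n], by simp, Set.mem_iUnion₂.2
        ⟨α n, j, Set.mem_iUnion.2 ⟨Ne.symm hj, ⟨a, ha, rfl⟩, hu⟩⟩⟩

theorem IsItinerary.prefixMap_apply {y : ℕ → X} (hy : IsItinerary S K α y) (n : ℕ) :
    prefixMap S α n (y n) = y 0 := by
  induction n with
  | zero => rfl
  | succ n ih => rw [prefixMap, Function.comp_apply, (hy n).2, ih]

theorem IsItinerary.isAddress {y : ℕ → X} (hy : IsItinerary S K α y) :
    IsAddress S K (y 0) α := fun n _ =>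
  ⟨y n, (hy n).1, by rw [← prefixMap_eq_SWord, hy.prefixMap_apply]⟩

theorem IsAddress.exists_isItinerary (hinj : ∀ i, Function.Injective (S i)) {x : X}
    (hx : x ∈ K) (hα : IsAddress S K x α) : ∃ y, y 0 = x ∧ IsItinerary S K α y := by
  have h : ∀ n, ∃ z ∈ K, prefixMap S α n z = x := fun n => by
    obtain rfl | hn := Nat.eq_zero_or_pos n
    · exact ⟨x, hx, rfl⟩
    · rw [prefixMap_eq_SWord]
      exact hα n hn
  choose y hyK hy using h
  exact ⟨y, hy 0, fun n => ⟨hyK n, prefixMap_injective hinj n ((hy (n + 1)).trans (hy n).symm)⟩⟩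

theorem exists_isItinerary (hK : K ⊆ ⋃ i, S i '' K) {x : X} (hx : x ∈ K) :
    ∃ β y, y 0 = x ∧ IsItinerary S K β y := by
  have h : ∀ z : K, ∃ (i : Fin m) (u : K), S i u = z := fun z => by
    obtain ⟨i, u, hu, hz⟩ := Set.mem_iUnion.1 (hK z.2)
    exact ⟨i, ⟨u, hu⟩, hz⟩
  choose d p hp using h
  refine ⟨fun n => d (p^[n] ⟨x, hx⟩), fun n => p^[n] ⟨x, hx⟩, rfl,
    fun n => ⟨Subtype.coe_prop _, ?_⟩⟩
  simp only [Function.iterate_succ_apply']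
  exact hp _

/-- Itineraries can be spliced where they pass through a common point. -/
theorem IsItinerary.splice {β : ℕ → Fin m} {y z : ℕ → X} (hy : IsItinerary S K α y)
    (hz : IsItinerary S K β z) {n : ℕ} (h : z 0 = y n) :
    IsItinerary S K (fun k => if k < n then α k else β (k - n))
      (fun k => if k < n then y k else z (k - n)) := by
  intro k
  obtain hk | rfl | hk : k + 1 < n ∨ k + 1 = n ∨ n ≤ k := by omega
  · simpa [hk, Nat.lt_of_succ_lt hk] using hy k
  · simpa [h] using hy k
  · simpa [not_lt.2 hk, not_lt.2 (Nat.le_succ_of_le hk), Nat.sub_add_comm hk] using hz (k - n)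

/-- If the base point has a unique address, so does every point of its itinerary. -/
theorem IsItinerary.eq_shift_of_unique {β : ℕ → Fin m} {y z : ℕ → X}
    (hy : IsItinerary S K α y) (huniq : ∀ β, IsAddress S K (y 0) β → β = α)
    (hz : IsItinerary S K β z) {n : ℕ} (h : z 0 = y n) (k : ℕ) : β k = α (n + k) := by
  have haddr := (hy.splice hz h).isAddress
  have h0 : (if 0 < n then y 0 else z (0 - n)) = y 0 := by
    obtain rfl | hn := Nat.eq_zero_or_pos n
    · simpa using h
    · simp [hn]
  rw [h0] at haddr
  simpa using congrFun (huniq _ haddr) (n + k)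

theorem IsItinerary.notMem_prefixRest (hinj : ∀ i, Function.Injective (S i))
    (hS : ∀ i, Set.MapsTo (S i) K K) (hK : K ⊆ ⋃ i, S i '' K) {y : ℕ → X}
    (hy : IsItinerary S K α y) (huniq : ∀ β, IsAddress S K (y 0) β → β = α) (n : ℕ) :
    y 0 ∉ prefixRest S K α n := by
  induction n with
  | zero => exact id
  | succ n ih =>
    rintro (h | h)
    · exact ih h
    · obtain ⟨j, hj, _, ⟨b, hb, rfl⟩, hbx⟩ := Set.mem_iUnion₂.1 h
      have hyn : S j b = y n := prefixMap_injective hinj n (hbx.trans (hy.prefixMap_apply n).symm)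
      obtain ⟨β, z, rfl, hz⟩ := exists_isItinerary hK hb
      have hz' : IsItinerary S K (fun k => Nat.casesOn k j β)
          (fun k => Nat.casesOn k (S j (z 0)) z) := by
        rintro (_ | k)
        · exact ⟨hS j hb, rfl⟩
        · exact hz k
      exact hj (hy.eq_shift_of_unique huniq hz' hyn 0)

end Words

/-- **Proposition 5.2(4)**: in a self-similar dendrite with finite self-similar
boundary, a ramification point with a unique address has a preperiodic address. -/
theorem ramification_point_unique_address_preperiodic
    {X : Type*} [MetricSpace X] [CompleteSpace X] {m : ℕ}
    (S : Fin m → X → X) (r : Fin m → NNReal) (hr : ∀ i, r i < 1)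
    (hlip : ∀ i, LipschitzWith (r i) (S i)) (hinj : ∀ i, Function.Injective (S i))
    (K : Set X) (hKne : K.Nonempty) (hKcp : IsCompact K) (hKeq : K = ⋃ i, S i '' K)
    (hdend : IsDendrite K) (hfin : (SSBoundary S K).Finite)
    (x : X) (hx : x ∈ K) (α : ℕ → Fin m)
    (hα : IsAddress S K x α) (huniq : ∀ β : ℕ → Fin m, IsAddress S K x β → β = α)
    (hram : ∃ C₁ ∈ ComponentsIn (K \ {x}), ∃ C₂ ∈ ComponentsIn (K \ {x}),
      ∃ C₃ ∈ ComponentsIn (K \ {x}), C₁ ≠ C₂ ∧ C₁ ≠ C₃ ∧ C₂ ≠ C₃) :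
    ∃ N T : ℕ, 1 ≤ T ∧ ∀ n : ℕ, N ≤ n → α (n + T) = α n := by
  obtain ⟨-, hconn, hloc, -⟩ := hdend
  have hcov : K ⊆ ⋃ i, S i '' K := hKeq.subset
  have hS : ∀ i, Set.MapsTo (S i) K K := fun i z hz => by
    rw [hKeq]
    exact Set.mem_iUnion.2 ⟨i, z, hz, rfl⟩
  have hcont : ∀ i, Continuous (S i) := fun i => (hlip i).continuous
  obtain ⟨y, rfl, hy⟩ := hα.exists_isItinerary hinj hx
  obtain ⟨p, hp, hpinj⟩ : ∃ p : Fin 3 → X, (∀ i, p i ∈ K \ {y 0}) ∧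
      Function.Injective fun i => connectedComponentIn (K \ {y 0}) (p i) := by
    obtain ⟨_, ⟨p₁, h₁, rfl⟩, _, ⟨p₂, h₂, rfl⟩, _, ⟨p₃, h₃, rfl⟩, h₁₂, h₁₃, h₂₃⟩ := hram
    refine ⟨![p₁, p₂, p₃], ?_, ?_⟩
    · intro i
      fin_cases i <;> assumption
    · intro i j hij
      fin_cases i <;> fin_cases j <;>
        first
        | rfl
        | exact (h₁₂ hij).elim
        | exact (h₁₃ hij).elim
        | exact (h₂₃ hij).elim
        | exact (h₁₂ hij.symm).elim
        | exact (h₁₃ hij.symm).elim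
        | exact (h₂₃ hij.symm).elim
  have hsmall : ∀ᶠ n in Filter.atTop, ∀ i, p i ∉ prefixMap S α n '' K := by
    obtain ⟨ρ, hρ, hrρ⟩ : ∃ ρ : NNReal, ρ < 1 ∧ ∀ i, r i ≤ ρ :=
      ⟨Finset.univ.sup r, (Finset.sup_lt_iff (by simp)).2 fun i _ => hr i,
        fun i => Finset.le_sup (Finset.mem_univ i)⟩
    refine Filter.eventually_all.2 fun i => ?_
    have hlim : Filter.Tendsto (fun n : ℕ => (ρ : ℝ) ^ n * Metric.diam K) Filter.atTop
        (nhds 0) := by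
      simpa using (tendsto_pow_atTop_nhds_zero_of_lt_one ρ.coe_nonneg hρ).mul_const (Metric.diam K)
    filter_upwards [hlim.eventually_lt_const (dist_pos.2 (hp i).2)]
    rintro n hn ⟨a, ha, hap⟩
    refine hn.not_ge ?_
    have hdist := (prefixMap_lipschitzWith (α := α)
      (fun i => (hlip i).weaken (hrρ i)) n).dist_le_mul a (y n)
    rw [hap, hy.prefixMap_apply] at hdist
    push_cast at hdist
    exact hdist.trans (mul_le_mul_of_nonneg_left
      (Metric.dist_le_diam_of_mem hKcp.isBounded ha (hy n).1) (by positivity))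
  obtain ⟨N, hN⟩ := Filter.eventually_atTop.1 hsmall
  have hsep : ∀ n : ℕ, ∃ a : Fin 3 → SSBoundary S K,
      SeparatesAll K (y (N + n)) fun i => (a i : X) := by
    intro n
    have hpoint : ∀ i, ∃ a : SSBoundary S K,
        prefixMap S α (N + n) a ∈ connectedComponentIn (K \ {y 0}) (p i) := by
      intro i
      have hclosed := isClosed_prefixRest (α := α) hKcp hcont (N + n)
      have hC := connectedComponentIn_subset (K \ {y 0}) (p i)
      have hunion := subset_image_prefixMap_union_prefixRest (α := α) hcov (N + n)
      obtain ⟨q, hq, hqC⟩ := mem_closure_iff.1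
        (mem_closure_connectedComponentIn_diff_singleton hconn hx (hp i)) _ hclosed.isOpen_compl
        (hy.notMem_prefixRest hinj hS hcov huniq (N + n))
      obtain ⟨z, hzC, ⟨a, ha, rfl⟩, hz⟩ := isPreconnected_closed_iff.1
        isPreconnected_connectedComponentIn _ _
        (hKcp.image (prefixMap_continuous hcont (N + n))).isClosed hclosed
        (fun z hz => hunion (hC hz).1)
        ⟨q, hqC, (hunion (hC hqC).1).resolve_right hq⟩
        ⟨p i, mem_connectedComponentIn (hp i),
          (hunion (hp i).1).resolve_left (hN _ (Nat.le_add_right _ _) i)⟩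
      exact ⟨⟨a, mem_SSBoundary_of_prefixMap_mem_prefixRest hinj hS _ ha hz⟩, hzC⟩
    choose a ha using hpoint
    refine ⟨a, SeparatesAll.of_map (prefixMap_continuous (α := α) hcont (N + n))
      (prefixMap_injective hinj _) (prefixMap_mapsTo hS _) (fun i => (a i).2.1) ?_⟩
    rw [hy.prefixMap_apply]
    refine ⟨fun i => connectedComponentIn_subset _ _ (ha i), fun i j hij => hpinj ?_⟩
    exact (connectedComponentIn_eq (ha i)).trans
      (Eq.trans hij (connectedComponentIn_eq (ha j)).symm)
  choose a ha using hsep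
  have := hfin.to_subtype
  obtain ⟨k, l, hkl, hakl⟩ : ∃ k l, k < l ∧ a k = a l := by
    obtain ⟨k, l, hkl, h⟩ := Finite.exists_ne_map_eq_of_infinite a
    obtain hlt | hlt := hkl.lt_or_gt
    · exact ⟨k, l, hlt, h⟩
    · exact ⟨l, k, hlt, h.symm⟩
  have hyy : y (N + k) = y (N + l) :=
    SeparatesAll.unique hconn (hy _).1 (ha k) (by simpa only [hakl] using ha l)
  have htail : IsItinerary S K (fun j => α (N + l + j)) (fun j => y (N + l + j)) :=
    fun j => hy (N + l + j)
  refine ⟨N + k, l - k, by omega, fun n hn => ?_⟩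
  have hshift := hy.eq_shift_of_unique huniq htail (n := N + k) hyy.symm (n - (N + k))
  convert hshift using 2 <;> omega
end
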